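/- arXiv:1410.5298 — 2 statements merged into one kernel-verified Lean document; each statement's English description precedes it below -/
import Mathlib

section
/- Let ω be a closed singular 2-form on U∖S with a singularity at m ∈ S, and suppose the singularity of ω at m is removable. Then there exist an open neighborhood V ⊆ U of m and a smooth function g : V → ℝ such that |g(x)| = ‖e^{−ω̂(x)}‖^{−1} for all x ∈ V∖S and g(m) = 0. In particular, the function x ↦ ‖e^{−ω̂(x)}‖^{−1} on V∖S extends continuously to V with value 0 at m. -/
noncomputable section

/-- The covector `ω(X,·) = (j ↦ Σᵢ Xᵢ ωᵢⱼ)` of the bilinear form with component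
matrix `A`, as a linear map `ℝⁿ → (ℝⁿ)* ≅ ℝⁿ`. -/
def covecMap {n : ℕ} (A : Fin n → Fin n → ℝ) : (Fin n → ℝ) →ₗ[ℝ] (Fin n → ℝ) :=
  (Matrix.of A).vecMulLinear

/-- The graph `{(X, ω(X,·)) : X ∈ ℝⁿ} ⊆ ℝⁿ × (ℝⁿ)*` of the bilinear form with
component matrix `A`, identifying `(ℝⁿ)*` with `ℝⁿ` via the dual standard basis. -/
def graphForm {n : ℕ} (A : Fin n → Fin n → ℝ) : Submodule ℝ ((Fin n → ℝ) × (Fin n → ℝ)) :=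
  LinearMap.graph (covecMap A)

/-- Partial derivative `∂ᵢ f (x)`. -/
def pd {n : ℕ} (f : (Fin n → ℝ) → ℝ) (i : Fin n) (x : Fin n → ℝ) : ℝ :=
  fderiv ℝ f x (Pi.single i 1)

/-- A singular 2-form on `U∖S`: smooth there, with alternating (skew) values. -/
def IsSingularTwoForm {n : ℕ} (U S : Set (Fin n → ℝ))
    (ω : (Fin n → ℝ) → Fin n → Fin n → ℝ) : Prop :=
  ContDiffOn ℝ (⊤ : ℕ∞) ω (U \ S) ∧ ∀ x ∈ U \ S, ∀ i j, ω x i j = - ω x j i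

/-- The 2-form `ω` is closed on the open set `O`:
`∂ᵢ ω_{jk} + ∂ⱼ ω_{ki} + ∂ₖ ω_{ij} = 0`. -/
def IsClosedTwoFormOn {n : ℕ} (ω : (Fin n → ℝ) → Fin n → Fin n → ℝ)
    (O : Set (Fin n → ℝ)) : Prop :=
  ∀ x ∈ O, ∀ i j k,
    pd (fun y => ω y j k) i x + pd (fun y => ω y k i) j x + pd (fun y => ω y i j) k x = 0

/-- `ω` has a singularity at `m ∈ S`: there is no smooth (skew-valued) extension of
`ω` to an open neighborhood of `m` inside `U`. -/
def HasSingularityAt {n : ℕ} (U S : Set (Fin n → ℝ))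
    (ω : (Fin n → ℝ) → Fin n → Fin n → ℝ) (m : Fin n → ℝ) : Prop :=
  ¬ ∃ (W : Set (Fin n → ℝ)) (ω' : (Fin n → ℝ) → Fin n → Fin n → ℝ),
      IsOpen W ∧ m ∈ W ∧ W ⊆ U ∧ ContDiffOn ℝ (⊤ : ℕ∞) ω' W ∧
      (∀ x ∈ W, ∀ i j, ω' x i j = - ω' x j i) ∧ ∀ x ∈ W \ S, ω' x = ω x

/-- The singularity of `ω` at `m` is removable in its graph: on some open
neighborhood `V ⊆ U` of `m` there are smooth, everywhere linearly independent
sections `s₁, …, sₙ : V → ℝⁿ × (ℝⁿ)*` spanning `Graph(ω(x))` at every `x ∈ V∖S`. -/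
def RemovableAt {n : ℕ} (U S : Set (Fin n → ℝ))
    (ω : (Fin n → ℝ) → Fin n → Fin n → ℝ) (m : Fin n → ℝ) : Prop :=
  ∃ (V : Set (Fin n → ℝ)) (s : Fin n → (Fin n → ℝ) → (Fin n → ℝ) × (Fin n → ℝ)),
    IsOpen V ∧ m ∈ V ∧ V ⊆ U ∧
    (∀ i, ContDiffOn ℝ (⊤ : ℕ∞) (s i) V) ∧
    (∀ x ∈ V, LinearIndependent ℝ (fun i => s i x)) ∧
    ∀ x ∈ V \ S, Submodule.span ℝ (Set.range fun i => s i x) = graphForm (ω x)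


/-- `ω̂ = Σ_{i<j} A_{ij} e^i ∧ e^j` in the exterior algebra of `ℝⁿ`
(our model for `Λ(ℝⁿ)*`, identifying `(ℝⁿ)*` with `ℝⁿ` via the standard basis). -/
def hatTwoForm {n : ℕ} (A : Fin n → Fin n → ℝ) : ExteriorAlgebra ℝ (Fin n → ℝ) :=
  ∑ i : Fin n, ∑ j : Fin n,
    if i < j then
      A i j • (ExteriorAlgebra.ι ℝ (Pi.single i 1) * ExteriorAlgebra.ι ℝ (Pi.single j 1))
    else 0

/-- `e^{-ω̂} = Σ_{k≥0} (-1)^k ω̂^{∧k}/k!` (a finite sum: all terms with `2k > n`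
vanish). -/
def expNegHat {n : ℕ} (A : Fin n → Fin n → ℝ) : ExteriorAlgebra ℝ (Fin n → ℝ) :=
  ∑ k ∈ Finset.range (n / 2 + 1), ((-1 : ℝ) ^ k / (Nat.factorial k : ℝ)) • hatTwoForm A ^ k

/-- The coefficient of `φ ∈ Λℝⁿ` on the wedge monomial `e^T = e_{t₁} ∧ ⋯ ∧ e_{tₖ}`
(`T = {t₁ < ⋯ < tₖ}`), extracted by successive contraction with the dual basis
functionals and taking the scalar part. -/
def monCoeff {n : ℕ} (T : Finset (Fin n)) (φ : ExteriorAlgebra ℝ (Fin n → ℝ)) : ℝ :=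
  ExteriorAlgebra.algebraMapInv
    ((T.sort (· ≤ ·)).foldl
      (fun ψ i =>
        CliffordAlgebra.contractLeft (M := Fin n → ℝ)
          (LinearMap.proj i : Module.Dual ℝ (Fin n → ℝ)) ψ)
      φ)


/-- The norm `‖φ‖` of `φ ∈ Λℝⁿ` for the Euclidean inner product making the wedge
monomials in the standard basis orthonormal. -/
def extNorm {n : ℕ} (φ : ExteriorAlgebra ℝ (Fin n → ℝ)) : ℝ :=
  Real.sqrt (∑ T : Finset (Fin n), monCoeff T φ ^ 2)

/-- The action of a section `(X, ξ)` of `ℝⁿ ⊕ (ℝⁿ)*` on spinors: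
`φ ↦ ι_X φ + ξ ∧ φ`. -/
def cliffordAct (n : ℕ) : ((Fin n → ℝ) × (Fin n → ℝ)) →ₗ[ℝ]
    ExteriorAlgebra ℝ (Fin n → ℝ) →ₗ[ℝ] ExteriorAlgebra ℝ (Fin n → ℝ) :=
  (CliffordAlgebra.contractLeft ∘ₗ dotProductBilin ℝ ℝ) ∘ₗ LinearMap.fst ℝ _ _ +
    (LinearMap.mul ℝ (ExteriorAlgebra ℝ (Fin n → ℝ)) ∘ₗ ExteriorAlgebra.ι ℝ) ∘ₗ
      LinearMap.snd ℝ _ _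

lemma cliffordAct_apply {n : ℕ} (v : (Fin n → ℝ) × (Fin n → ℝ))
    (φ : ExteriorAlgebra ℝ (Fin n → ℝ)) :
    cliffordAct n v φ = CliffordAlgebra.contractLeft (dotProductBilin ℝ ℝ v.1) φ +
      ExteriorAlgebra.ι ℝ v.2 * φ := rfl

lemma dotProductBilin_single {n : ℕ} (i : Fin n) :
    dotProductBilin ℝ ℝ (Pi.single i 1) =
      (LinearMap.proj i : Module.Dual ℝ (Fin n → ℝ)) := by
  ext j
  simp [Pi.single_apply, eq_comm]

lemma cliffordAct_sq {n : ℕ} (v : (Fin n → ℝ) × (Fin n → ℝ))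
    (φ : ExteriorAlgebra ℝ (Fin n → ℝ)) :
    cliffordAct n v (cliffordAct n v φ) = (v.1 ⬝ᵥ v.2) • φ := by
  simp only [cliffordAct_apply, map_add, ExteriorAlgebra.ι,
    CliffordAlgebra.contractLeft_contractLeft, CliffordAlgebra.contractLeft_ι_mul, ← mul_assoc]
  rw [ExteriorAlgebra.ι_sq_zero]
  simp

lemma cliffordAct_anticomm {n : ℕ} (v w : (Fin n → ℝ) × (Fin n → ℝ))
    (φ : ExteriorAlgebra ℝ (Fin n → ℝ)) :
    cliffordAct n v (cliffordAct n w φ) + cliffordAct n w (cliffordAct n v φ) =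
      (v.1 ⬝ᵥ w.2 + w.1 ⬝ᵥ v.2) • φ := by
  have h := cliffordAct_sq (v + w) φ
  simp only [map_add, LinearMap.add_apply, cliffordAct_sq, Prod.fst_add, Prod.snd_add,
    add_dotProduct, dotProduct_add, add_smul] at h
  rw [add_smul]
  linear_combination (norm := module) h

/-- Exchange of the `i`-th coordinates of the two components, for `i ∈ I`. -/
def swapCoords {n : ℕ} (I : Finset (Fin n)) (v : (Fin n → ℝ) × (Fin n → ℝ)) :
    (Fin n → ℝ) × (Fin n → ℝ) :=
  (I.piecewise v.2 v.1, I.piecewise v.1 v.2)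

lemma swapCoords_swapCoords {n : ℕ} (I : Finset (Fin n)) (v : (Fin n → ℝ) × (Fin n → ℝ)) :
    swapCoords I (swapCoords I v) = v := by
  ext j <;> by_cases hj : j ∈ I <;> simp [swapCoords, hj]

lemma swapCoords_insert {n : ℕ} {I : Finset (Fin n)} {i : Fin n} (hi : i ∉ I)
    (v : (Fin n → ℝ) × (Fin n → ℝ)) :
    swapCoords (insert i I) v = swapCoords I v + ((swapCoords I v).2 i - (swapCoords I v).1 i) •
      (Pi.single i 1, -Pi.single i 1) := by
  ext j <;> by_cases hij : j = i
  · subst hij; simp [swapCoords, hi]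
  · by_cases hj : j ∈ I <;> simp [swapCoords, hj, hij]
  · subst hij; simp [swapCoords, hi]
  · by_cases hj : j ∈ I <;> simp [swapCoords, hj, hij]

/-- Iterated contraction with the coordinate functionals in a list. -/
def listContract {n : ℕ} :
    List (Fin n) → ExteriorAlgebra ℝ (Fin n → ℝ) →ₗ[ℝ] ExteriorAlgebra ℝ (Fin n → ℝ)
  | [] => LinearMap.id
  | i :: l => listContract l ∘ₗ
      CliffordAlgebra.contractLeft (LinearMap.proj i : Module.Dual ℝ (Fin n → ℝ))

lemma foldl_contractLeft_eq_listContract {n : ℕ} (l : List (Fin n))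
    (φ : ExteriorAlgebra ℝ (Fin n → ℝ)) :
    l.foldl (fun ψ i => CliffordAlgebra.contractLeft (M := Fin n → ℝ)
          (LinearMap.proj i : Module.Dual ℝ (Fin n → ℝ)) ψ) φ = listContract l φ := by
  induction l generalizing φ with
  | nil => rfl
  | cons i l ih => exact ih _

/-- `monCoeff T` as a linear functional. -/
def monCoeffLin {n : ℕ} (T : Finset (Fin n)) : ExteriorAlgebra ℝ (Fin n → ℝ) →ₗ[ℝ] ℝ :=
  ExteriorAlgebra.algebraMapInv.toLinearMap ∘ₗ listContract (T.sort (· ≤ ·))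

lemma monCoeff_eq_monCoeffLin {n : ℕ} (T : Finset (Fin n)) (φ : ExteriorAlgebra ℝ (Fin n → ℝ)) :
    monCoeff T φ = monCoeffLin T φ := by
  simp only [monCoeff, foldl_contractLeft_eq_listContract]
  rfl

lemma listContract_perm {n : ℕ} {l l' : List (Fin n)} (h : l.Perm l') :
    listContract l = listContract l' ∨ listContract l = -listContract l' := by
  induction h with
  | nil => exact .inl rfl
  | cons i _ ih =>
    rcases ih with h | h
    · exact .inl (by simp only [listContract, h])
    · exact .inr (by simp only [listContract, h, LinearMap.neg_comp])
  | swap i j l =>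
    right
    refine LinearMap.ext fun φ => ?_
    simp only [listContract, LinearMap.comp_apply, LinearMap.neg_apply]
    rw [CliffordAlgebra.contractLeft_comm, map_neg]
  | trans _ _ h₁ h₂ =>
    rcases h₁ with h₁ | h₁ <;> rcases h₂ with h₂ | h₂ <;> simp [h₁, h₂]

lemma monCoeffLin_insert_sq {n : ℕ} {T : Finset (Fin n)} {i : Fin n} (hi : i ∉ T)
    (φ : ExteriorAlgebra ℝ (Fin n → ℝ)) :
    monCoeffLin (insert i T) φ ^ 2 =
      monCoeffLin T (CliffordAlgebra.contractLeft (LinearMap.proj i) φ) ^ 2 := by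
  have hp : ((insert i T).sort (· ≤ ·)).Perm (i :: T.sort (· ≤ ·)) := by
    refine (Finset.sort_perm_toList _ _).trans ((Finset.toList_insert hi).trans ?_)
    exact (Finset.sort_perm_toList _ _).symm.cons i
  rcases listContract_perm hp with h | h <;>
    simp [monCoeffLin, h, listContract]

lemma monCoeffLin_empty {n : ℕ} (φ : ExteriorAlgebra ℝ (Fin n → ℝ)) :
    monCoeffLin ∅ φ = ExteriorAlgebra.algebraMapInv φ := by
  simp [monCoeffLin, listContract]

lemma algebraMapInv_ι_mul {n : ℕ} (x : Fin n → ℝ) (φ : ExteriorAlgebra ℝ (Fin n → ℝ)) :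
    ExteriorAlgebra.algebraMapInv (ExteriorAlgebra.ι ℝ x * φ) = 0 := by
  simp [ExteriorAlgebra.algebraMapInv]

lemma contractLeft_proj_single_mul {n : ℕ} (i j : Fin n) (φ : ExteriorAlgebra ℝ (Fin n → ℝ)) :
    CliffordAlgebra.contractLeft (LinearMap.proj i : Module.Dual ℝ (Fin n → ℝ))
      (ExteriorAlgebra.ι ℝ (Pi.single j 1) * φ) =
    (if i = j then φ else 0) - ExteriorAlgebra.ι ℝ (Pi.single j 1) *
      CliffordAlgebra.contractLeft (LinearMap.proj i : Module.Dual ℝ (Fin n → ℝ)) φ := by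
  rw [ExteriorAlgebra.ι, CliffordAlgebra.contractLeft_ι_mul]
  by_cases h : i = j <;> simp [h]

lemma monCoeffLin_single_mul_of_notMem {n : ℕ} {T : Finset (Fin n)} {i : Fin n} (hi : i ∉ T)
    (φ : ExteriorAlgebra ℝ (Fin n → ℝ)) :
    monCoeffLin T (ExteriorAlgebra.ι ℝ (Pi.single i 1) * φ) = 0 := by
  induction T using Finset.induction_on generalizing φ with
  | empty => rw [monCoeffLin_empty, algebraMapInv_ι_mul]
  | insert j T hj ih =>
    rw [Finset.mem_insert, not_or] at hi
    rw [← sq_eq_zero_iff, monCoeffLin_insert_sq hj, contractLeft_proj_single_mul,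
      if_neg (Ne.symm hi.1), zero_sub, map_neg, ih hi.2]
    simp

lemma monCoeffLin_insert_single_mul_sq {n : ℕ} {T : Finset (Fin n)} {i : Fin n} (hi : i ∉ T)
    (φ : ExteriorAlgebra ℝ (Fin n → ℝ)) :
    monCoeffLin (insert i T) (ExteriorAlgebra.ι ℝ (Pi.single i 1) * φ) ^ 2 =
      monCoeffLin T φ ^ 2 := by
  rw [monCoeffLin_insert_sq hi, contractLeft_proj_single_mul, if_pos rfl, map_sub,
    monCoeffLin_single_mul_of_notMem hi, sub_zero]

lemma monCoeffLin_insert_contractLeft {n : ℕ} {T : Finset (Fin n)} {i : Fin n} (hi : i ∉ T)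
    (φ : ExteriorAlgebra ℝ (Fin n → ℝ)) :
    monCoeffLin (insert i T) (CliffordAlgebra.contractLeft (LinearMap.proj i) φ) = 0 := by
  rw [← sq_eq_zero_iff, monCoeffLin_insert_sq hi, CliffordAlgebra.contractLeft_contractLeft]
  simp

lemma cliffordAct_single_neg_single {n : ℕ} (i : Fin n) (φ : ExteriorAlgebra ℝ (Fin n → ℝ)) :
    cliffordAct n (Pi.single i 1, -Pi.single i 1) φ =
      CliffordAlgebra.contractLeft (LinearMap.proj i : Module.Dual ℝ (Fin n → ℝ)) φ -
        ExteriorAlgebra.ι ℝ (Pi.single i 1) * φ := by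
  rw [cliffordAct_apply, dotProductBilin_single]
  simp [sub_eq_add_neg]

lemma monCoeffLin_cliffordAct_sq {n : ℕ} (i : Fin n) (T : Finset (Fin n))
    (φ : ExteriorAlgebra ℝ (Fin n → ℝ)) :
    monCoeffLin T (cliffordAct n (Pi.single i 1, -Pi.single i 1) φ) ^ 2 =
      monCoeffLin (symmDiff {i} T) φ ^ 2 := by
  rw [cliffordAct_single_neg_single, map_sub]
  by_cases hi : i ∈ T
  · obtain ⟨T, hi', rfl⟩ : ∃ T', i ∉ T' ∧ insert i T' = T :=
      ⟨T.erase i, Finset.notMem_erase i T, Finset.insert_erase hi⟩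
    have hT : symmDiff {i} (insert i T) = T := by
      ext j
      simp only [Finset.mem_symmDiff, Finset.mem_singleton, Finset.mem_insert]
      grind
    rw [monCoeffLin_insert_contractLeft hi', zero_sub, neg_sq,
      monCoeffLin_insert_single_mul_sq hi', hT]
  · have hT : symmDiff {i} T = insert i T := by
      ext j
      simp only [Finset.mem_symmDiff, Finset.mem_singleton, Finset.mem_insert]
      grind
    rw [monCoeffLin_single_mul_of_notMem hi, sub_zero, hT, monCoeffLin_insert_sq hi]

lemma sum_monCoeffLin_cliffordAct_sq {n : ℕ} (i : Fin n)
    (φ : ExteriorAlgebra ℝ (Fin n → ℝ)) :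
    ∑ T, monCoeffLin T (cliffordAct n (Pi.single i 1, -Pi.single i 1) φ) ^ 2 =
      ∑ T, monCoeffLin T φ ^ 2 := by
  simp only [monCoeffLin_cliffordAct_sq]
  exact Equiv.sum_comp (symmDiff_right_involutive ({i} : Finset (Fin n))).toPerm
    fun T => monCoeffLin T φ ^ 2

/-- The coordinate exchange `swapCoords I` is implemented on spinors by a linear isometry. -/
lemma exists_isometry_swapCoords {n : ℕ} (I : Finset (Fin n)) :
    ∃ τ : ExteriorAlgebra ℝ (Fin n → ℝ) →ₗ[ℝ] ExteriorAlgebra ℝ (Fin n → ℝ),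
      (∀ φ, ∑ T, monCoeffLin T (τ φ) ^ 2 = ∑ T, monCoeffLin T φ ^ 2) ∧
      ∀ v φ, cliffordAct n v φ = 0 → cliffordAct n (swapCoords I v) (τ φ) = 0 := by
  induction I using Finset.induction_on with
  | empty => exact ⟨LinearMap.id, fun _ => rfl, fun v φ h => by simpa [swapCoords] using h⟩
  | insert i I hi ih =>
    obtain ⟨τ, h₁, h₂⟩ := ih
    refine ⟨cliffordAct n (Pi.single i 1, -Pi.single i 1) ∘ₗ τ, fun φ => ?_, fun v φ hv => ?_⟩
    · rw [← h₁ φ]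
      exact sum_monCoeffLin_cliffordAct_sq i (τ φ)
    · rw [swapCoords_insert hi]
      set w := swapCoords I v with hw
      have h := cliffordAct_anticomm w (Pi.single i 1, -Pi.single i 1) (τ φ)
      rw [h₂ v φ hv, map_zero, add_zero] at h
      rw [map_add, LinearMap.add_apply, LinearMap.comp_apply, h, map_smul, LinearMap.smul_apply,
        cliffordAct_sq, smul_smul, ← add_smul]
      simp

/-- A spinor annihilated by the graph of a form vanishes if its scalar part does. -/
lemma monCoeffLin_eq_zero_of_cliffordAct {n : ℕ} (A : Fin n → Fin n → ℝ)
    (φ : ExteriorAlgebra ℝ (Fin n → ℝ))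
    (h : ∀ i, cliffordAct n (Pi.single i 1, A i) φ = 0)
    (h₀ : ExteriorAlgebra.algebraMapInv φ = 0) (T : Finset (Fin n)) :
    monCoeffLin T φ = 0 := by
  induction T using Finset.strongInduction with
  | H T ih =>
    rcases T.eq_empty_or_nonempty with rfl | ⟨i, hi⟩
    · rw [monCoeffLin_empty, h₀]
    obtain ⟨T, hi', rfl⟩ : ∃ T', i ∉ T' ∧ insert i T' = T :=
      ⟨T.erase i, Finset.notMem_erase i T, Finset.insert_erase hi⟩
    have hA := h i
    rw [cliffordAct_apply, dotProductBilin_single, add_eq_zero_iff_eq_neg] at hA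
    have hexp : A i = ∑ j, A i j • (Pi.single j 1 : Fin n → ℝ) := pi_eq_sum_univ' (A i)
    rw [← sq_eq_zero_iff, monCoeffLin_insert_sq hi', hA, map_neg, neg_sq, sq_eq_zero_iff]
    simp only
    rw [hexp, map_sum, Finset.sum_mul, map_sum]
    refine Finset.sum_eq_zero fun j _ => ?_
    rw [map_smul, smul_mul_assoc, map_smul]
    refine smul_eq_zero_of_right _ ?_
    by_cases hj : j ∈ T
    · obtain ⟨T', hj', rfl⟩ : ∃ T', j ∉ T' ∧ insert j T' = T :=
        ⟨T.erase j, Finset.notMem_erase j T, Finset.insert_erase hj⟩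
      rw [← sq_eq_zero_iff, monCoeffLin_insert_single_mul_sq hj', ih T', sq, zero_mul]
      refine Finset.ssubset_iff.2 ⟨j, hj', ?_⟩
      exact Finset.subset_insert _ _
    · exact monCoeffLin_single_mul_of_notMem hj φ

lemma hatTwoForm_mem {n : ℕ} (A : Fin n → Fin n → ℝ) :
    hatTwoForm A ∈ LinearMap.range (ExteriorAlgebra.ι ℝ : (Fin n → ℝ) →ₗ[ℝ] _) ^ 2 := by
  refine Submodule.sum_mem _ fun i _ => Submodule.sum_mem _ fun j _ => ?_
  split_ifs
  · rw [sq]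
    exact Submodule.smul_mem _ _ (Submodule.mul_mem_mul ⟨_, rfl⟩ ⟨_, rfl⟩)
  · exact zero_mem _

lemma hatTwoForm_pow_eq_zero {n : ℕ} (A : Fin n → Fin n → ℝ) :
    hatTwoForm A ^ (n / 2 + 1) = 0 := by
  have hmem : hatTwoForm A ^ (n / 2 + 1) ∈
      LinearMap.range (ExteriorAlgebra.ι ℝ : (Fin n → ℝ) →ₗ[ℝ] _) ^ (2 * (n / 2 + 1)) := by
    rw [pow_mul]
    exact Submodule.pow_mem_pow _ (hatTwoForm_mem A) _
  have hbot : LinearMap.range (ExteriorAlgebra.ι ℝ : (Fin n → ℝ) →ₗ[ℝ] _) ^ (2 * (n / 2 + 1))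
      = ⊥ := by
    refine (ExteriorAlgebra.ιMulti_span_fixedDegree ℝ _).symm.trans ?_
    rw [Submodule.span_eq_bot]
    rintro _ ⟨v, rfl⟩
    refine AlternatingMap.map_linearDependent _ _ fun hv => ?_
    have := hv.fintype_card_le_finrank
    rw [Fintype.card_fin, Module.finrank_fin_fun] at this
    omega
  rwa [hbot] at hmem

lemma ι_mul_hatTwoForm {n : ℕ} (A : Fin n → Fin n → ℝ) (x : Fin n → ℝ) :
    ExteriorAlgebra.ι ℝ x * hatTwoForm A = hatTwoForm A * ExteriorAlgebra.ι ℝ x := by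
  simp only [hatTwoForm, Finset.mul_sum, Finset.sum_mul]
  refine Finset.sum_congr rfl fun i _ => Finset.sum_congr rfl fun j _ => ?_
  split_ifs
  · rw [mul_smul_comm, smul_mul_assoc]
    congr 1
    have h₁ := eq_neg_of_add_eq_zero_left
      (ExteriorAlgebra.ι_add_mul_swap (R := ℝ) x (Pi.single i 1))
    have h₂ := eq_neg_of_add_eq_zero_left
      (ExteriorAlgebra.ι_add_mul_swap (R := ℝ) x (Pi.single j 1))
    rw [← mul_assoc, h₁, neg_mul, mul_assoc, h₂, mul_neg, neg_neg, mul_assoc]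
  · simp

lemma contractLeft_hatTwoForm_mul {n : ℕ} {A : Fin n → Fin n → ℝ} (hA : ∀ i j, A i j = -A j i)
    (i : Fin n) (φ : ExteriorAlgebra ℝ (Fin n → ℝ)) :
    CliffordAlgebra.contractLeft (LinearMap.proj i : Module.Dual ℝ (Fin n → ℝ))
      (hatTwoForm A * φ) = ExteriorAlgebra.ι ℝ (A i) * φ + hatTwoForm A *
      CliffordAlgebra.contractLeft (LinearMap.proj i : Module.Dual ℝ (Fin n → ℝ)) φ := by
  have key : ∀ p q : Fin n,
      CliffordAlgebra.contractLeft (LinearMap.proj i : Module.Dual ℝ (Fin n → ℝ))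
        ((if p < q then A p q • (ExteriorAlgebra.ι ℝ (Pi.single p 1) *
          ExteriorAlgebra.ι ℝ (Pi.single q 1)) else 0) * φ) =
      ((if p < q then A p q • ((if i = p then ExteriorAlgebra.ι ℝ (Pi.single q 1) else 0) -
        (if i = q then ExteriorAlgebra.ι ℝ (Pi.single p 1) else 0)) else 0) * φ) +
      (if p < q then A p q • (ExteriorAlgebra.ι ℝ (Pi.single p 1) *
          ExteriorAlgebra.ι ℝ (Pi.single q 1)) else 0) *
        CliffordAlgebra.contractLeft (LinearMap.proj i : Module.Dual ℝ (Fin n → ℝ)) φ := by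
    intro p q
    by_cases hpq : p < q
    · simp only [if_pos hpq, smul_mul_assoc, map_smul, mul_assoc, contractLeft_proj_single_mul,
        ← smul_add, mul_sub, sub_mul, ite_mul, mul_ite, zero_mul, mul_zero]
      congr 1
      abel
    · simp [hpq]
  have hsum : ∑ p, ∑ q, (if p < q then A p q •
      ((if i = p then ExteriorAlgebra.ι ℝ (Pi.single q 1) else 0) -
        (if i = q then ExteriorAlgebra.ι ℝ (Pi.single p 1 : Fin n → ℝ) else 0)) else 0) =
      ExteriorAlgebra.ι ℝ (A i) := by
    have hexp : A i = ∑ j, A i j • (Pi.single j 1 : Fin n → ℝ) := pi_eq_sum_univ' (A i)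
    rw [hexp, map_sum]
    have : ∀ p q : Fin n, (if p < q then A p q •
      ((if i = p then ExteriorAlgebra.ι ℝ (Pi.single q 1) else 0) -
        (if i = q then ExteriorAlgebra.ι ℝ (Pi.single p 1 : Fin n → ℝ) else 0)) else 0) =
      (if i = p then (if i < q then A i q • ExteriorAlgebra.ι ℝ (Pi.single q 1) else 0) else 0) +
      (if i = q then (if p < i then A i p • ExteriorAlgebra.ι ℝ (Pi.single p 1 : Fin n → ℝ)
        else 0) else 0) := by
      intro p q
      by_cases hp : i = p <;> by_cases hq : i = q
      · subst hp; subst hq; simp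
      · subst hp; simp [hq]
      · subst hq; simp [hp, hA i p]
      · simp [hp, hq]
    simp only [this, Finset.sum_add_distrib]
    rw [Finset.sum_comm]
    simp only [Finset.sum_ite_eq, Finset.mem_univ, if_true]
    rw [← Finset.sum_add_distrib]
    refine Finset.sum_congr rfl fun q _ => ?_
    rw [map_smul]
    rcases lt_trichotomy i q with h | h | h
    · simp [h, h.not_gt]
    · subst h
      have : A i i = 0 := by linarith [hA i i]
      simp [this]
    · simp [h, h.not_gt]
  rw [← hsum]
  simp only [hatTwoForm, Finset.sum_mul, map_sum, key, Finset.sum_add_distrib]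

lemma contractLeft_hatTwoForm_pow {n : ℕ} {A : Fin n → Fin n → ℝ} (hA : ∀ i j, A i j = -A j i)
    (i : Fin n) (k : ℕ) :
    CliffordAlgebra.contractLeft (LinearMap.proj i : Module.Dual ℝ (Fin n → ℝ))
      (hatTwoForm A ^ (k + 1)) =
      ((k + 1 : ℕ) : ℝ) • (ExteriorAlgebra.ι ℝ (A i) * hatTwoForm A ^ k) := by
  induction k with
  | zero =>
    rw [zero_add, pow_succ', contractLeft_hatTwoForm_mul hA]
    simp
  | succ k ih =>
    rw [pow_succ', contractLeft_hatTwoForm_mul hA, ih, mul_smul_comm, ← mul_assoc (hatTwoForm A),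
      ← ι_mul_hatTwoForm, mul_assoc, ← pow_succ', Nat.cast_succ (k + 1), add_smul, one_smul,
      add_comm]

lemma ι_mul_hatTwoForm_pow_eq_zero {n : ℕ} {A : Fin n → Fin n → ℝ}
    (hA : ∀ i j, A i j = -A j i) (i : Fin n) :
    ExteriorAlgebra.ι ℝ (A i) * hatTwoForm A ^ (n / 2) = 0 := by
  have h := contractLeft_hatTwoForm_pow hA i (n / 2)
  rw [hatTwoForm_pow_eq_zero, map_zero] at h
  exact (smul_eq_zero.1 h.symm).resolve_left (by positivity)

/-- `e^{-ω̂}` is annihilated by the graph of `ω`. -/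
lemma cliffordAct_expNegHat {n : ℕ} {A : Fin n → Fin n → ℝ} (hA : ∀ i j, A i j = -A j i)
    (i : Fin n) : cliffordAct n (Pi.single i 1, A i) (expNegHat A) = 0 := by
  rw [cliffordAct_apply, dotProductBilin_single]
  simp only [expNegHat, map_sum, map_smul, Finset.mul_sum, mul_smul_comm]
  rw [Finset.sum_range_succ', Finset.sum_range_succ _ (n / 2), ι_mul_hatTwoForm_pow_eq_zero hA]
  rw [pow_zero (hatTwoForm A), CliffordAlgebra.contractLeft_one, smul_zero, smul_zero, add_zero,
    add_zero, ← Finset.sum_add_distrib]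
  refine Finset.sum_eq_zero fun k _ => ?_
  rw [contractLeft_hatTwoForm_pow hA, smul_smul, ← add_smul]
  refine smul_eq_zero_of_left ?_ _
  rw [Nat.factorial_succ]
  have : (Nat.factorial k : ℝ) ≠ 0 := by positivity
  have : ((k + 1 : ℕ) : ℝ) ≠ 0 := by positivity
  push_cast at *
  field_simp
  ring

lemma algebraMapInv_hatTwoForm {n : ℕ} (A : Fin n → Fin n → ℝ) :
    ExteriorAlgebra.algebraMapInv (hatTwoForm A) = 0 := by
  simp only [hatTwoForm, map_sum]
  refine Finset.sum_eq_zero fun i _ => Finset.sum_eq_zero fun j _ => ?_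
  split_ifs
  · rw [map_smul, algebraMapInv_ι_mul, smul_zero]
  · exact map_zero _

lemma algebraMapInv_expNegHat {n : ℕ} (A : Fin n → Fin n → ℝ) :
    ExteriorAlgebra.algebraMapInv (expNegHat A) = 1 := by
  rw [expNegHat, map_sum, Finset.sum_range_succ']
  simp [algebraMapInv_hatTwoForm]

lemma extNorm_eq {n : ℕ} (φ : ExteriorAlgebra ℝ (Fin n → ℝ)) :
    extNorm φ = √(∑ T, monCoeffLin T φ ^ 2) := by
  simp only [extNorm, monCoeff_eq_monCoeffLin]

lemma extNorm_of_cliffordAct {n : ℕ} {A : Fin n → Fin n → ℝ} (hA : ∀ i j, A i j = -A j i)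
    {ψ : ExteriorAlgebra ℝ (Fin n → ℝ)} (hψ : ∀ i, cliffordAct n (Pi.single i 1, A i) ψ = 0) :
    extNorm ψ = |ExteriorAlgebra.algebraMapInv ψ| * extNorm (expNegHat A) := by
  have key : ∀ T, monCoeffLin T ψ =
      ExteriorAlgebra.algebraMapInv ψ * monCoeffLin T (expNegHat A) := by
    intro T
    rw [← sub_eq_zero, ← smul_eq_mul, ← map_smul, ← map_sub]
    refine monCoeffLin_eq_zero_of_cliffordAct A _ (fun i => ?_) ?_ T
    · rw [map_sub, map_smul, hψ, cliffordAct_expNegHat hA, smul_zero, sub_zero]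
    · rw [map_sub, map_smul, algebraMapInv_expNegHat, smul_eq_mul, mul_one, sub_self]
  simp only [extNorm_eq, key, mul_pow, ← Finset.mul_sum]
  rw [Real.sqrt_mul (sq_nonneg _), Real.sqrt_sq_eq_abs]

lemma one_le_sum_monCoeffLin_expNegHat {n : ℕ} (A : Fin n → Fin n → ℝ) :
    1 ≤ ∑ T, monCoeffLin T (expNegHat A) ^ 2 := by
  have h := Finset.single_le_sum (f := fun T => monCoeffLin T (expNegHat A) ^ 2)
    (fun T _ => sq_nonneg _) (Finset.mem_univ ∅)
  simpa [monCoeffLin_empty, algebraMapInv_expNegHat] using h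

lemma algebraMapInv_contractLeft_contractLeft {n : ℕ} {A : Fin n → Fin n → ℝ}
    {ψ : ExteriorAlgebra ℝ (Fin n → ℝ)} (hψ : ∀ i, cliffordAct n (Pi.single i 1, A i) ψ = 0)
    (i j : Fin n) :
    ExteriorAlgebra.algebraMapInv
      (CliffordAlgebra.contractLeft (LinearMap.proj j : Module.Dual ℝ (Fin n → ℝ))
        (CliffordAlgebra.contractLeft (LinearMap.proj i : Module.Dual ℝ (Fin n → ℝ)) ψ)) =
      -(A i j * ExteriorAlgebra.algebraMapInv ψ) := by
  have h := hψ i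
  rw [cliffordAct_apply, dotProductBilin_single, add_eq_zero_iff_eq_neg] at h
  rw [h, map_neg, ExteriorAlgebra.ι, CliffordAlgebra.contractLeft_ι_mul, map_neg, map_sub,
    algebraMapInv_ι_mul, map_smul]
  simp

lemma mem_graphForm {n : ℕ} {A : Fin n → Fin n → ℝ} {v : (Fin n → ℝ) × (Fin n → ℝ)} :
    v ∈ graphForm A ↔ v.2 = Matrix.vecMul v.1 (Matrix.of A) := by
  rw [graphForm, LinearMap.mem_graph_iff]
  rfl

lemma single_mem_graphForm {n : ℕ} (A : Fin n → Fin n → ℝ) (i : Fin n) :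
    (Pi.single i 1, A i) ∈ graphForm A := by
  rw [mem_graphForm]
  ext j
  simp

lemma cliffordAct_of_mem_graphForm {n : ℕ} {A : Fin n → Fin n → ℝ}
    {ψ : ExteriorAlgebra ℝ (Fin n → ℝ)} (hψ : ∀ i, cliffordAct n (Pi.single i 1, A i) ψ = 0)
    {v : (Fin n → ℝ) × (Fin n → ℝ)} (hv : v ∈ graphForm A) : cliffordAct n v ψ = 0 := by
  have h : v = ∑ i, v.1 i • ((Pi.single i 1, A i) : (Fin n → ℝ) × (Fin n → ℝ)) := by
    rw [mem_graphForm] at hv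
    refine Prod.ext ?_ ?_
    · rw [Prod.fst_sum]
      exact pi_eq_sum_univ' _
    · rw [hv, Prod.snd_sum]
      ext j
      simp [Matrix.vecMul, dotProduct]
  rw [h, map_sum, LinearMap.sum_apply]
  exact Finset.sum_eq_zero fun i _ => by rw [map_smul, LinearMap.smul_apply, hψ, smul_zero]

open scoped Matrix in
lemma dotProduct_add_dotProduct_of_mem_graphForm {n : ℕ} {A : Fin n → Fin n → ℝ}
    (hA : ∀ i j, A i j = -A j i) {v w : (Fin n → ℝ) × (Fin n → ℝ)}
    (hv : v ∈ graphForm A) (hw : w ∈ graphForm A) : v.1 ⬝ᵥ w.2 + w.1 ⬝ᵥ v.2 = 0 := by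
  have hT : (Matrix.of A)ᵀ = -Matrix.of A := by
    ext i j
    simp [hA j i]
  rw [mem_graphForm] at hv hw
  rw [hv, hw, dotProduct_comm w.1, ← Matrix.dotProduct_mulVec, ← Matrix.vecMul_transpose, hT,
    Matrix.vecMul_neg, dotProduct_neg, add_neg_cancel]

lemma swapCoords_dotProduct {n : ℕ} (I : Finset (Fin n)) (v w : (Fin n → ℝ) × (Fin n → ℝ)) :
    (swapCoords I v).1 ⬝ᵥ (swapCoords I w).2 + (swapCoords I w).1 ⬝ᵥ (swapCoords I v).2 =
      v.1 ⬝ᵥ w.2 + w.1 ⬝ᵥ v.2 := by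
  simp only [dotProduct, ← Finset.sum_add_distrib]
  refine Finset.sum_congr rfl fun j _ => ?_
  by_cases hj : j ∈ I <;> (simp [swapCoords, hj]; try ring)

/-- A frame of a Lagrangian subspace becomes transversal to `(ℝⁿ)*` after exchanging suitable
coordinates. -/
lemma exists_det_swapCoords_ne_zero {n : ℕ} (s : Fin n → (Fin n → ℝ) × (Fin n → ℝ))
    (hs : LinearIndependent ℝ s) (hiso : ∀ r q, (s r).1 ⬝ᵥ (s q).2 + (s q).1 ⬝ᵥ (s r).2 = 0) :
    ∃ I, (Matrix.of fun r => (swapCoords I (s r)).1).det ≠ 0 := by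
  by_contra! hI
  have hdet : (Matrix.of fun r => (s r).2 + (s r).1).det = 0 := by
    rw [← Matrix.det_transpose]
    have h := (Matrix.detRowAlternating (R := ℝ) (n := Fin n)).toMultilinearMap.map_add_univ
      (fun j r => (s r).2 j) (fun j r => (s r).1 j)
    refine h.trans (Finset.sum_eq_zero fun I _ => ?_)
    rw [← hI I, ← Matrix.det_transpose]
    refine congrArg Matrix.det ?_
    ext j r
    by_cases hj : j ∈ I <;> simp [swapCoords, hj]
  obtain ⟨v, hv, hv'⟩ := Matrix.exists_vecMul_eq_zero_iff.2 hdet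
  apply hv
  set w := ∑ r, v r • s r with hw
  have hsum : w.2 + w.1 = 0 := by
    rw [← hv', hw]
    ext j
    simp [Matrix.vecMul, dotProduct, Prod.fst_sum, Prod.snd_sum, mul_add, Finset.sum_add_distrib]
  have hww : w.1 ⬝ᵥ w.2 + w.1 ⬝ᵥ w.2 = 0 := by
    have h1 : w.1 ⬝ᵥ w.2 = ∑ r, ∑ q, v r * v q * ((s r).1 ⬝ᵥ (s q).2) := by
      simp only [hw, Prod.fst_sum, Prod.snd_sum, sum_dotProduct, dotProduct_sum, Prod.smul_fst,
        Prod.smul_snd, smul_dotProduct, dotProduct_smul, smul_eq_mul, mul_assoc, Finset.mul_sum]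
      rw [Finset.sum_comm]
      exact Finset.sum_congr rfl fun r _ => Finset.sum_congr rfl fun q _ => by ring
    have h2 : w.1 ⬝ᵥ w.2 = ∑ r, ∑ q, v r * v q * ((s q).1 ⬝ᵥ (s r).2) := by
      rw [h1, Finset.sum_comm]
      exact Finset.sum_congr rfl fun r _ => Finset.sum_congr rfl fun q _ => by ring
    conv_lhs => rw [h1]
    conv_lhs => enter [2]; rw [← h1, h2]
    rw [← Finset.sum_add_distrib]
    refine Finset.sum_eq_zero fun r _ => ?_
    rw [← Finset.sum_add_distrib]
    refine Finset.sum_eq_zero fun q _ => ?_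
    rw [← mul_add, hiso, mul_zero]
  have hw2 : w.2 = -w.1 := eq_neg_of_add_eq_zero_left hsum
  have hw1 : w.1 = 0 := by
    rw [hw2, dotProduct_neg] at hww
    exact dotProduct_self_eq_zero.1 (by linarith)
  have hw0 : w = 0 := Prod.ext hw1 (by rw [hw2, hw1]; simp)
  funext r
  exact Fintype.linearIndependent_iff.1 hs v hw0 r

open scoped Matrix in
lemma skew_of_isotropic {n : ℕ} {P Q : Matrix (Fin n) (Fin n) ℝ} (hP : P.det ≠ 0)
    (hiso : ∀ r q, P r ⬝ᵥ Q q + P q ⬝ᵥ Q r = 0) (i j : Fin n) :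
    (P⁻¹ * Q) i j = -(P⁻¹ * Q) j i := by
  have hu : IsUnit P.det := hP.isUnit
  have h : P * Qᵀ + Q * Pᵀ = 0 := by
    ext r q
    refine Eq.trans ?_ (hiso r q)
    rw [dotProduct_comm (P q)]
    rfl
  have hT : (P⁻¹ * Q)ᵀ + P⁻¹ * Q = 0 := by
    have h' : P⁻¹ * (P * Qᵀ + Q * Pᵀ) * (P⁻¹)ᵀ = 0 := by rw [h]; simp
    rw [mul_add, ← mul_assoc P⁻¹ P, Matrix.nonsing_inv_mul _ hu, one_mul, add_mul,
      ← Matrix.transpose_mul, ← mul_assoc, mul_assoc (P⁻¹ * Q), ← Matrix.transpose_mul,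
      Matrix.nonsing_inv_mul _ hu, Matrix.transpose_one, mul_one] at h'
    exact h'
  have := congrFun (congrFun hT j) i
  simp only [Matrix.add_apply, Matrix.transpose_apply, Matrix.zero_apply] at this
  linarith

lemma contDiffOn_det {E : Type*} [NormedAddCommGroup E] [NormedSpace ℝ E] {n : ℕ} {V : Set E}
    {k : WithTop ℕ∞} {M : E → Matrix (Fin n) (Fin n) ℝ}
    (hM : ∀ i j, ContDiffOn ℝ k (fun x => M x i j) V) :
    ContDiffOn ℝ k (fun x => (M x).det) V := by
  simp only [Matrix.det_apply']
  exact ContDiffOn.sum fun σ _ => contDiffOn_const.mul (contDiffOn_prod fun i _ => hM _ _)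

lemma contDiffOn_inv_mul {E : Type*} [NormedAddCommGroup E] [NormedSpace ℝ E] {n : ℕ} {V : Set E}
    {k : WithTop ℕ∞} {M N : E → Matrix (Fin n) (Fin n) ℝ}
    (hM : ∀ i j, ContDiffOn ℝ k (fun x => M x i j) V)
    (hN : ∀ i j, ContDiffOn ℝ k (fun x => N x i j) V) (hdet : ∀ x ∈ V, (M x).det ≠ 0)
    (i j : Fin n) : ContDiffOn ℝ k (fun x => ((M x)⁻¹ * N x) i j) V := by
  simp only [Matrix.mul_apply, Matrix.inv_def, Ring.inverse_eq_inv', Matrix.smul_apply,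
    smul_eq_mul, Matrix.adjugate_apply]
  refine ContDiffOn.sum fun l _ => (((contDiffOn_det hM).inv hdet).mul
    (contDiffOn_det fun p q => ?_)).mul (hN l j)
  by_cases hp : p = l
  · subst hp
    simpa using contDiffOn_const
  · simpa [Matrix.updateRow_ne hp] using hM p q

lemma contDiffOn_linear_expNegHat {E : Type*} [NormedAddCommGroup E] [NormedSpace ℝ E] {n : ℕ}
    {V : Set E} {k : WithTop ℕ∞} {B : E → Fin n → Fin n → ℝ}
    (hB : ∀ i j, ContDiffOn ℝ k (fun x => B x i j) V)
    (l : ExteriorAlgebra ℝ (Fin n → ℝ) →ₗ[ℝ] ℝ) :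
    ContDiffOn ℝ k (fun x => l (expNegHat (B x))) V := by
  have hpow : ∀ (p : ℕ) (l : ExteriorAlgebra ℝ (Fin n → ℝ) →ₗ[ℝ] ℝ),
      ContDiffOn ℝ k (fun x => l (hatTwoForm (B x) ^ p)) V := by
    intro p
    induction p with
    | zero => intro l; simpa using contDiffOn_const
    | succ p ih =>
      intro l
      simp only [pow_succ', hatTwoForm.eq_def, Finset.sum_mul, map_sum]
      refine ContDiffOn.sum fun i _ => ContDiffOn.sum fun j _ => ?_
      by_cases hij : i < j
      · simp only [if_pos hij, smul_mul_assoc, map_smul, smul_eq_mul]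
        exact (hB i j).mul (ih (l ∘ₗ LinearMap.mulLeft ℝ (ExteriorAlgebra.ι ℝ (Pi.single i 1) *
          ExteriorAlgebra.ι ℝ (Pi.single j 1))))
      · simpa [hij] using contDiffOn_const
  simp only [expNegHat, map_sum, map_smul, smul_eq_mul]
  exact ContDiffOn.sum fun p _ => contDiffOn_const.mul (hpow p l)

/-- If a closed singular 2-form `ω` on `U∖S` has a removable
singularity at `m ∈ S`, then near `m` there is a smooth function `g` with
`|g| = ‖e^{-ω̂}‖⁻¹` off `S` and `g m = 0`; in particular `x ↦ ‖e^{-ω̂(x)}‖⁻¹`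
extends continuously over `m` with value `0`. -/
theorem stmt_13 {n : ℕ} (hn : 2 ≤ n) (U S : Set (Fin n → ℝ))
    (hU : IsOpen U) (hSU : S ⊆ U) (hUS : IsOpen (U \ S)) (hdense : U ⊆ closure (U \ S))
    (ω : (Fin n → ℝ) → Fin n → Fin n → ℝ)
    (hω : IsSingularTwoForm U S ω) (hcl : IsClosedTwoFormOn ω (U \ S))
    (m : Fin n → ℝ) (hm : m ∈ S) (hsing : HasSingularityAt U S ω m)
    (hrem : RemovableAt U S ω m) :
    ∃ (V : Set (Fin n → ℝ)) (g : (Fin n → ℝ) → ℝ),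
      IsOpen V ∧ m ∈ V ∧ V ⊆ U ∧
      ContDiffOn ℝ (⊤ : ℕ∞) g V ∧
      (∀ x ∈ V \ S, |g x| = (extNorm (expNegHat (ω x)))⁻¹) ∧
      g m = 0 ∧
      ∃ h : (Fin n → ℝ) → ℝ,
        ContinuousOn h V ∧ (∀ x ∈ V \ S, h x = (extNorm (expNegHat (ω x)))⁻¹) ∧ h m = 0 := by
  obtain ⟨V₀, s, hV₀, hmV₀, hV₀U, hs, hli, hspan⟩ := hrem
  have hA : ∀ x ∈ V₀ \ S, ∀ i j, ω x i j = -ω x j i := fun x hx => hω.2 x ⟨hV₀U hx.1, hx.2⟩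
  have hgraph : ∀ x ∈ V₀ \ S, ∀ r, s r x ∈ graphForm (ω x) := fun x hx r => by
    rw [← hspan x hx]
    exact Submodule.subset_span ⟨r, rfl⟩
  have hs1 : ∀ r j, ContDiffOn ℝ (⊤ : ℕ∞) (fun x => (s r x).1 j) V₀ := fun r =>
    contDiffOn_pi.1 (hs r).fst
  have hs2 : ∀ r j, ContDiffOn ℝ (⊤ : ℕ∞) (fun x => (s r x).2 j) V₀ := fun r =>
    contDiffOn_pi.1 (hs r).snd
  have hisoS : ∀ x ∈ V₀ \ S, ∀ r q, (s r x).1 ⬝ᵥ (s q x).2 + (s q x).1 ⬝ᵥ (s r x).2 = 0 :=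
    fun x hx r q =>
      dotProduct_add_dotProduct_of_mem_graphForm (hA x hx) (hgraph x hx r) (hgraph x hx q)
  have hisom : ∀ r q, (s r m).1 ⬝ᵥ (s q m).2 + (s q m).1 ⬝ᵥ (s r m).2 = 0 := by
    intro r q
    by_contra hne
    have hc : ContinuousOn (fun x => (s r x).1 ⬝ᵥ (s q x).2 + (s q x).1 ⬝ᵥ (s r x).2) V₀ := by
      simp only [dotProduct]
      exact (continuousOn_finsetSum _ fun j _ =>
        (hs1 r j).continuousOn.mul (hs2 q j).continuousOn).add
          (continuousOn_finsetSum _ fun j _ =>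
            (hs1 q j).continuousOn.mul (hs2 r j).continuousOn)
    obtain ⟨x, ⟨hxV, hx⟩, hxU, hxS⟩ := mem_closure_iff.1 (hdense (hSU hm)) _
      (hc.isOpen_inter_preimage hV₀ isOpen_compl_singleton) ⟨hmV₀, hne⟩
    exact hx (hisoS x ⟨hxV, hxS⟩ r q)
  obtain ⟨I, hI⟩ := exists_det_swapCoords_ne_zero _ (hli m hmV₀) hisom
  obtain ⟨τ, hτ, hτ'⟩ := exists_isometry_swapCoords I
  set P : (Fin n → ℝ) → Matrix (Fin n) (Fin n) ℝ :=
    fun x => Matrix.of fun r => (swapCoords I (s r x)).1 with hP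
  set Q : (Fin n → ℝ) → Matrix (Fin n) (Fin n) ℝ :=
    fun x => Matrix.of fun r => (swapCoords I (s r x)).2 with hQ
  have hPs : ∀ r j, ContDiffOn ℝ (⊤ : ℕ∞) (fun x => P x r j) V₀ := fun r j => by
    by_cases hj : j ∈ I
    · simpa [hP, swapCoords, hj] using hs2 r j
    · simpa [hP, swapCoords, hj] using hs1 r j
  have hQs : ∀ r j, ContDiffOn ℝ (⊤ : ℕ∞) (fun x => Q x r j) V₀ := fun r j => by
    by_cases hj : j ∈ I
    · simpa [hQ, swapCoords, hj] using hs1 r j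
    · simpa [hQ, swapCoords, hj] using hs2 r j
  set V : Set (Fin n → ℝ) := V₀ ∩ (fun x => (P x).det) ⁻¹' {0}ᶜ with hV
  have hVV₀ : V ⊆ V₀ := Set.inter_subset_left
  have hVo : IsOpen V :=
    (contDiffOn_det hPs).continuousOn.isOpen_inter_preimage hV₀ isOpen_compl_singleton
  have hmV : m ∈ V := ⟨hmV₀, hI⟩
  set B : (Fin n → ℝ) → Fin n → Fin n → ℝ := fun x => (P x)⁻¹ * Q x with hB
  have hBs : ∀ i j, ContDiffOn ℝ (⊤ : ℕ∞) (fun x => B x i j) V :=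
    contDiffOn_inv_mul (fun r j => (hPs r j).mono hVV₀) (fun r j => (hQs r j).mono hVV₀)
      fun x hx => hx.2
  set ψ : (Fin n → ℝ) → ExteriorAlgebra ℝ (Fin n → ℝ) := fun x => τ (expNegHat (B x)) with hψ
  have hψs : ∀ l : ExteriorAlgebra ℝ (Fin n → ℝ) →ₗ[ℝ] ℝ,
      ContDiffOn ℝ (⊤ : ℕ∞) (fun x => l (ψ x)) V := fun l =>
    contDiffOn_linear_expNegHat hBs (l ∘ₗ τ)
  have hann : ∀ x ∈ V \ S, ∀ i, cliffordAct n (Pi.single i 1, ω x i) (ψ x) = 0 := by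
    intro x hx i
    have hx₀ : x ∈ V₀ \ S := ⟨hVV₀ hx.1, hx.2⟩
    have hBskew : ∀ i j, B x i j = -B x j i := skew_of_isotropic hx.1.2 fun r q => by
      have h := hisoS x hx₀ r q
      rw [← swapCoords_dotProduct I] at h
      exact h
    have hr : ∀ r, cliffordAct n (s r x) (ψ x) = 0 := fun r => by
      rw [← swapCoords_swapCoords I (s r x)]
      refine hτ' _ _ (cliffordAct_of_mem_graphForm (cliffordAct_expNegHat hBskew) ?_)
      rw [mem_graphForm]
      have h : P x * ((P x)⁻¹ * Q x) = Q x := by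
        rw [← mul_assoc, Matrix.mul_nonsing_inv _ (Ne.isUnit hx.1.2), one_mul]
      exact (congrFun h r).symm
    have hmem := single_mem_graphForm (ω x) i
    rw [← hspan x hx₀] at hmem
    have hle : Submodule.span ℝ (Set.range fun r => s r x) ≤
        LinearMap.ker ((cliffordAct n).flip (ψ x)) := by
      rw [Submodule.span_le]
      rintro _ ⟨r, rfl⟩
      exact hr r
    exact hle hmem
  set N : (Fin n → ℝ) → ℝ := fun x => √(∑ T, monCoeffLin T (expNegHat (B x)) ^ 2) with hN
  have hNpos : ∀ x, 0 < N x := fun x =>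
    Real.sqrt_pos.2 (one_pos.trans_le (one_le_sum_monCoeffLin_expNegHat (B x)))
  have hNs : ContDiffOn ℝ (⊤ : ℕ∞) N V :=
    (ContDiffOn.sum fun T _ => (contDiffOn_linear_expNegHat hBs (monCoeffLin T)).pow 2).sqrt
      fun x _ => (one_pos.trans_le (one_le_sum_monCoeffLin_expNegHat (B x))).ne'
  set c : (Fin n → ℝ) → ℝ := fun x => ExteriorAlgebra.algebraMapInv (ψ x) with hc
  have hcs : ContDiffOn ℝ (⊤ : ℕ∞) c V := hψs ExteriorAlgebra.algebraMapInv.toLinearMap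
  have hgs : ContDiffOn ℝ (⊤ : ℕ∞) (fun x => c x / N x) V :=
    hcs.div hNs fun x _ => (hNpos x).ne'
  have habs : ∀ x ∈ V \ S, |c x / N x| = (extNorm (expNegHat (ω x)))⁻¹ := by
    intro x hx
    have h := extNorm_of_cliffordAct (hA x ⟨hVV₀ hx.1, hx.2⟩) (hann x hx)
    have hNx : N x = |c x| * extNorm (expNegHat (ω x)) := by
      rw [← h, extNorm_eq]
      simp only [hψ, hτ, hN]
    have hpos := hNpos x
    rw [abs_div, abs_of_pos hpos, div_eq_iff hpos.ne', hNx, mul_comm, mul_assoc,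
      mul_inv_cancel₀, mul_one]
    rintro h0
    rw [hNx, h0, mul_zero] at hpos
    exact hpos.false
  have hcm : c m = 0 := by
    by_contra hne
    refine hsing ⟨V ∩ c ⁻¹' {0}ᶜ, fun x i j => -(ExteriorAlgebra.algebraMapInv
      (CliffordAlgebra.contractLeft (LinearMap.proj j : Module.Dual ℝ (Fin n → ℝ))
        (CliffordAlgebra.contractLeft (LinearMap.proj i : Module.Dual ℝ (Fin n → ℝ)) (ψ x))) /
        c x), hcs.continuousOn.isOpen_inter_preimage hVo isOpen_compl_singleton, ⟨hmV, hne⟩,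
      fun x hx => hV₀U (hVV₀ hx.1), ?_, fun x _ i j => ?_, fun x hx => ?_⟩
    · refine contDiffOn_pi.2 fun i => contDiffOn_pi.2 fun j => ContDiffOn.neg (ContDiffOn.div
        ((hψs (ExteriorAlgebra.algebraMapInv.toLinearMap ∘ₗ CliffordAlgebra.contractLeft
          (LinearMap.proj j : Module.Dual ℝ (Fin n → ℝ)) ∘ₗ CliffordAlgebra.contractLeft
          (LinearMap.proj i : Module.Dual ℝ (Fin n → ℝ)))).mono Set.inter_subset_left)
        (hcs.mono Set.inter_subset_left) fun x hx => hx.2)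
    · beta_reduce
      rw [CliffordAlgebra.contractLeft_comm, map_neg, neg_div]
    · funext i j
      have hcx : c x ≠ 0 := hx.1.2
      beta_reduce
      rw [algebraMapInv_contractLeft_contractLeft (hann x ⟨hx.1.1, hx.2⟩), neg_div, neg_neg,
        mul_div_assoc, div_self hcx, mul_one]
  refine ⟨V, fun x => c x / N x, hVo, hmV, hVV₀.trans hV₀U, hgs, habs, by simp [hcm],
    fun x => |c x / N x|, hgs.continuousOn.abs, habs, by simp [hcm]⟩


end
end

section
/- Let ω be a closed singular 2-form on U∖S with a singularity at m ∈ S. Suppose there is an open neighborhood V ⊆ U of m such that: (i) there exist p ≥ 0 and smooth maps u₁, …, u_p : V → ℝⁿ, linearly independent at every point of V, with span{u₁(x), …, u_p(x)} = ker ω(x) for every x ∈ V∖S; and (ii) there exists a smooth Poisson bivector Π on V such that ω(x) and Π(x) are partial inverses for every x ∈ V∖S. Then the singularity of ω at m is removable. -/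
noncomputable section

/-- A linearly independent family in `ℝⁿ` extends to one of `n` vectors. -/
lemma exists_linearIndependent_sumElim {n p : ℕ} {v : Fin p → Fin n → ℝ}
    (hv : LinearIndependent ℝ v) :
    ∃ (q : ℕ) (w : Fin q → Fin n → ℝ), Nonempty (Fin p ⊕ Fin q ≃ Fin n) ∧
      LinearIndependent ℝ (Sum.elim v w) := by
  obtain ⟨C, hC⟩ := Submodule.exists_isCompl (Submodule.span ℝ (Set.range v))
  have hcard := Submodule.finrank_add_eq_of_isCompl hC
  rw [finrank_span_eq_card hv, Fintype.card_fin, Module.finrank_fin_fun] at hcard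
  let b := Module.finBasis ℝ C
  refine ⟨Module.finrank ℝ C, fun i => (b i : Fin n → ℝ),
    ⟨finSumFinEquiv.trans (finCongr hcard)⟩, ?_⟩
  refine hv.sum_type (b.linearIndependent.map' C.subtype C.ker_subtype) ?_
  refine hC.disjoint.mono_right ?_
  rw [Submodule.span_le]
  rintro _ ⟨i, rfl⟩
  exact (b i).2

lemma ContDiffOn.matrix_det {E : Type*} [NormedAddCommGroup E] [NormedSpace ℝ E]
    {ι : Type*} [Fintype ι] [DecidableEq ι] {k : WithTop ℕ∞} {s : Set E}
    {M : E → Matrix ι ι ℝ} (hM : ∀ i j, ContDiffOn ℝ k (fun x => M x i j) s) :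
    ContDiffOn ℝ k (fun x => (M x).det) s := by
  simp only [Matrix.det_apply']
  exact ContDiffOn.sum fun σ _ =>
    contDiffOn_const.mul (contDiffOn_prod fun i _ => hM _ _)

lemma ContDiffOn.matrix_adjugate {E : Type*} [NormedAddCommGroup E] [NormedSpace ℝ E]
    {ι : Type*} [Fintype ι] [DecidableEq ι] {k : WithTop ℕ∞} {s : Set E}
    {M : E → Matrix ι ι ℝ} (hM : ∀ i j, ContDiffOn ℝ k (fun x => M x i j) s) (i j : ι) :
    ContDiffOn ℝ k (fun x => (M x).adjugate i j) s := by
  simp only [Matrix.adjugate_apply]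
  refine ContDiffOn.matrix_det fun a b => ?_
  simp only [Matrix.updateRow_apply]
  split_ifs
  · exact contDiffOn_const
  · exact hM a b

/-- Around each point, the annihilator of a smooth linearly independent family is
framed by smooth covector fields. -/
lemma exists_smooth_annihilator_frame {n p : ℕ} {V : Set (Fin n → ℝ)} (hV : IsOpen V)
    {m : Fin n → ℝ} (hmV : m ∈ V) {u : Fin p → (Fin n → ℝ) → (Fin n → ℝ)}
    (hu : ∀ i, ContDiffOn ℝ (⊤ : ℕ∞) (u i) V)
    (hum : LinearIndependent ℝ (fun i => u i m)) :
    ∃ (W : Set (Fin n → ℝ)) (q : ℕ) (α : Fin q → (Fin n → ℝ) → (Fin n → ℝ)),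
      IsOpen W ∧ m ∈ W ∧ W ⊆ V ∧ Nonempty (Fin p ⊕ Fin q ≃ Fin n) ∧
      (∀ j, ContDiffOn ℝ (⊤ : ℕ∞) (α j) W) ∧
      ∀ x ∈ W, LinearIndependent ℝ (fun j => α j x) ∧ ∀ i j, α j x ⬝ᵥ u i x = 0 := by
  obtain ⟨q, w, ⟨e⟩, hw⟩ := exists_linearIndependent_sumElim hum
  let M : (Fin n → ℝ) → Matrix (Fin n) (Fin n) ℝ :=
    fun x => Matrix.of fun i => Sum.elim (fun k => u k x) w (e.symm i)
  have hM : ∀ i j, ContDiffOn ℝ (⊤ : ℕ∞) (fun x => M x i j) V := by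
    intro i j
    simp only [M, Matrix.of_apply]
    rcases e.symm i with k | k
    · exact contDiffOn_pi.1 (hu k) j
    · exact contDiffOn_const
  have hdet := ContDiffOn.matrix_det hM
  have hdetm : (M m).det ≠ 0 := by
    rw [← isUnit_iff_ne_zero, ← Matrix.isUnit_iff_isUnit_det,
      ← Matrix.linearIndependent_rows_iff_isUnit]
    exact hw.comp _ e.symm.injective
  refine ⟨V ∩ (fun x => (M x).det) ⁻¹' {0}ᶜ, q,
    fun j x i => (M x).adjugate i (e (Sum.inr j)),
    hdet.continuousOn.isOpen_inter_preimage hV isOpen_compl_singleton, ⟨hmV, hdetm⟩,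
    Set.inter_subset_left, ⟨e⟩, fun j => contDiffOn_pi.2 fun i =>
      (ContDiffOn.matrix_adjugate hM i _).mono Set.inter_subset_left, ?_⟩
  rintro x ⟨-, hx⟩
  constructor
  · have hunit : IsUnit (M x).adjugate := by
      rw [Matrix.isUnit_iff_isUnit_det, Matrix.det_adjugate]
      exact (isUnit_iff_ne_zero.2 hx).pow _
    exact (Matrix.linearIndependent_cols_iff_isUnit.2 hunit).comp _
      (e.injective.comp Sum.inr_injective)
  · intro i j
    have h := congrFun (congrFun (Matrix.mul_adjugate (M x)) (e (Sum.inl i))) (e (Sum.inr j))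
    simp only [Matrix.smul_apply, Matrix.one_apply, e.injective.eq_iff, reduceCtorEq,
      if_false, smul_zero] at h
    rw [dotProduct_comm, ← h]
    simp [M, Matrix.mul_apply, dotProduct]

/-- If `P` is a partial inverse of the skew form `A`, then `A(αP,·) = α` for every
covector `α` annihilating `ker A`. -/
lemma covecMap_vecMul_of_annihilates_ker {n : ℕ} {A P : Fin n → Fin n → ℝ}
    (hA : ∀ i j, A i j = - A j i)
    (hAPA : Matrix.of A * Matrix.of P * Matrix.of A = Matrix.of A) {α : Fin n → ℝ}
    (hα : ∀ X ∈ LinearMap.ker (covecMap A), α ⬝ᵥ X = 0) :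
    covecMap A (Matrix.vecMul α (Matrix.of P)) = α := by
  have hT : Matrix.transpose (Matrix.of A) = - Matrix.of A := by
    ext i j
    exact hA j i
  change Matrix.vecMul (Matrix.vecMul α (Matrix.of P)) (Matrix.of A) = α
  refine dotProduct_eq _ _ fun X => ?_
  have hker : Matrix.mulVec (Matrix.of P) (Matrix.mulVec (Matrix.of A) X) - X ∈
      LinearMap.ker (covecMap A) := by
    change Matrix.vecMul _ (Matrix.of A) = 0
    rw [← Matrix.mulVec_transpose, hT, Matrix.neg_mulVec, Matrix.mulVec_sub,
      Matrix.mulVec_mulVec, Matrix.mulVec_mulVec, hAPA, sub_self, neg_zero]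
  have h := hα _ hker
  rw [dotProduct_sub, sub_eq_zero, Matrix.dotProduct_mulVec, Matrix.dotProduct_mulVec] at h
  exact h

lemma linearIndependent_sumElim_prod {R M N ι κ : Type*} [Ring R] [AddCommGroup M]
    [Module R M] [AddCommGroup N] [Module R N] [Fintype ι] [Fintype κ]
    {u : ι → M} {β : κ → M} {α : κ → N}
    (hu : LinearIndependent R u) (hα : LinearIndependent R α) :
    LinearIndependent R
      (Sum.elim (fun i => (u i, (0 : N))) (fun j => (β j, α j)) : ι ⊕ κ → M × N) := by
  rw [Fintype.linearIndependent_iff] at hu hα ⊢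
  intro g hg
  have h1 := congrArg Prod.fst hg
  have h2 := congrArg Prod.snd hg
  simp only [Fintype.sum_sum_type, Sum.elim_inl, Sum.elim_inr, Prod.snd_add, Prod.fst_add,
    Prod.snd_sum, Prod.fst_sum, Prod.smul_mk, smul_zero, Finset.sum_const_zero, zero_add,
    Prod.snd_zero, Prod.fst_zero] at h1 h2
  have hr := hα _ h2
  simp only [hr, zero_smul, Finset.sum_const_zero, add_zero] at h1
  rintro (i | j)
  · exact hu _ h1 i
  · exact hr j

lemma finrank_graphForm {n : ℕ} (A : Fin n → Fin n → ℝ) :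
    Module.finrank ℝ (graphForm A) = n := by
  rw [graphForm, LinearMap.graph_eq_range_prod, LinearMap.finrank_range_of_inj,
    Module.finrank_fin_fun]
  intro x y h
  exact congrArg Prod.fst h

/-- (Prop. `PartialRemovable`.)  Let `ω` be a closed singular
2-form on `U∖S` with a singularity at `m ∈ S`.  If on some open neighborhood
`V ⊆ U` of `m` (i) the kernel distribution `ker ω` is spanned off `S` by smooth
sections `u₁, …, u_p` of `V` that are linearly independent at every point of `V`,
and (ii) there is a smooth Poisson bivector `P` on `V` that is a pointwise partial
inverse of `ω` off `S`, then the singularity of `ω` at `m` is removable. -/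
theorem stmt_16 {n : ℕ} (hn : 2 ≤ n) (U S : Set (Fin n → ℝ))
    (hU : IsOpen U) (hSU : S ⊆ U) (hUS : IsOpen (U \ S)) (hdense : U ⊆ closure (U \ S))
    (ω : (Fin n → ℝ) → Fin n → Fin n → ℝ)
    (hω : IsSingularTwoForm U S ω) (hcl : IsClosedTwoFormOn ω (U \ S))
    (m : Fin n → ℝ) (hm : m ∈ S) (hsing : HasSingularityAt U S ω m)
    (V : Set (Fin n → ℝ)) (hV : IsOpen V) (hmV : m ∈ V) (hVU : V ⊆ U)
    (p : ℕ) (u : Fin p → (Fin n → ℝ) → (Fin n → ℝ))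
    (hu : ∀ i, ContDiffOn ℝ (⊤ : ℕ∞) (u i) V)
    (huli : ∀ x ∈ V, LinearIndependent ℝ (fun i => u i x))
    (huker : ∀ x ∈ V \ S,
      Submodule.span ℝ (Set.range fun i => u i x) = LinearMap.ker (covecMap (ω x)))
    (P : (Fin n → ℝ) → Fin n → Fin n → ℝ)
    (hP : ContDiffOn ℝ (⊤ : ℕ∞) P V)
    (hPalt : ∀ x ∈ V, ∀ i j, P x i j = - P x j i)
    (hPjac : ∀ x ∈ V, ∀ i j k,
      ∑ l, (P x l i * pd (fun y => P y j k) l x + P x l j * pd (fun y => P y k i) l x +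
        P x l k * pd (fun y => P y i j) l x) = 0)
    (hpartial : ∀ x ∈ V \ S,
      Matrix.of (ω x) * Matrix.of (P x) * Matrix.of (ω x) = Matrix.of (ω x) ∧
      Matrix.of (P x) * Matrix.of (ω x) * Matrix.of (P x) = Matrix.of (P x)) :
    RemovableAt U S ω m := by
  obtain ⟨W, q, α, hW, hmW, hWV, ⟨e⟩, hα, hαx⟩ :=
    exists_smooth_annihilator_frame hV hmV hu (huli m hmV)
  let s : Fin p ⊕ Fin q → (Fin n → ℝ) → (Fin n → ℝ) × (Fin n → ℝ) :=
    fun t x => Sum.elim (fun i => (u i x, (0 : Fin n → ℝ)))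
      (fun j => (Matrix.vecMul (α j x) (Matrix.of (P x)), α j x)) t
  have hsli : ∀ x ∈ W, LinearIndependent ℝ (fun i => s (e.symm i) x) := fun x hx =>
    (linearIndependent_sumElim_prod (huli x (hWV hx)) (hαx x hx).1).comp _ e.symm.injective
  have hs : ∀ t, ContDiffOn ℝ (⊤ : ℕ∞) (s t) W := by
    rintro (k | j)
    · exact ((hu k).mono hWV).prodMk contDiffOn_const
    · exact (contDiffOn_pi.2 fun l => ContDiffOn.sum (s := Finset.univ) fun a _ =>
        (contDiffOn_pi.1 (hα j) a).mul (contDiffOn_pi.1 (contDiffOn_pi.1 (hP.mono hWV) a) l)).prodMk (hα j)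
  refine ⟨W, fun i => s (e.symm i), hW, hmW, hWV.trans hVU, fun i => hs _, hsli, ?_⟩
  rintro x ⟨hxW, hxS⟩
  have hxV : x ∈ V \ S := ⟨hWV hxW, hxS⟩
  refine Submodule.eq_of_le_of_finrank_eq ?_ ?_
  · rw [Submodule.span_le]
    rintro _ ⟨i, rfl⟩
    rw [SetLike.mem_coe, graphForm, LinearMap.mem_graph_iff]
    rcases h : e.symm i with k | j <;> simp only [h, s, Sum.elim_inl, Sum.elim_inr]
    · symm
      rw [← LinearMap.mem_ker, ← huker x hxV]
      exact Submodule.subset_span ⟨k, rfl⟩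
    · refine (covecMap_vecMul_of_annihilates_ker (hω.2 x ⟨hVU hxV.1, hxS⟩)
        (hpartial x hxV).1 fun X hX => ?_).symm
      rw [← huker x hxV] at hX
      induction hX using Submodule.span_induction with
      | mem y hy =>
        obtain ⟨i, rfl⟩ := hy
        exact (hαx x hxW).2 i j
      | zero => exact dotProduct_zero _
      | add y z _ _ hy hz => rw [dotProduct_add, hy, hz, add_zero]
      | smul c y _ hy => rw [dotProduct_smul, hy, smul_zero]
  · rw [finrank_span_eq_card (hsli x hxW), Fintype.card_fin, finrank_graphForm]

end
end
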